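/- Let α > 0, let r satisfy 0 < r ≤ α, and let ρ satisfy 0 < ρ ≤ r/2. Set h₁ = ρ(2α−ρ)/(2(α+r−ρ)), 𝒞(h₁) = {x ∈ ℝ² : −h₁ ≤ ⟨x,e₂⟩ ≤ 0} ∩ B(−r e₂, r), Q₁ = {(x₁,x₂) ∈ ℝ² : x₁ ≥ 0} and Q₂ = {(x₁,x₂) ∈ ℝ² : x₁ ≤ 0}. Then for i = 1, 2 and every y ∈ Qᵢ ∩ ℱ_r, one has Qᵢ ∩ 𝒞(h₁) ⊆ B(y,r). -/

import Mathlib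

open MeasureTheory Metric Set
open scoped RealInnerProductSpace ENNReal

noncomputable section

/-- The Euclidean plane. -/
abbrev E2 := EuclideanSpace ℝ (Fin 2)

/-- The point `(a, b)` of the Euclidean plane. -/
def pt (a b : ℝ) : E2 := (WithLp.equiv 2 (Fin 2 → ℝ)).symm ![a, b]

/-- The unit vector `e₂ = (0, 1)`. -/
def e₂ : E2 := pt 0 1

/-- `𝒞(h) = {x : −h ≤ ⟪x, e₂⟫ ≤ 0} ∩ B(−r e₂, r)`. -/
def Cset (h r : ℝ) : Set E2 :=
  {x : E2 | -h ≤ ⟪x, e₂⟫ ∧ ⟪x, e₂⟫ ≤ 0} ∩ closedBall (-(r • e₂)) r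

/-- `ℱ_r = {y ∈ B(0,r) : ⟪y, e₂⟫ < −‖y‖/2}`. -/
def Fset (r : ℝ) : Set E2 := {y ∈ closedBall (0 : E2) r | ⟪y, e₂⟫ < -(‖y‖ / 2)}

/-- The right half-plane `Q₁`. -/
def Q1 : Set E2 := {x : E2 | 0 ≤ x 0}

/-- The left half-plane `Q₂`. -/
def Q2 : Set E2 := {x : E2 | x 0 ≤ 0}

lemma le_of_sq_le_sq_aux {x y : ℝ} (h : x ^ 2 ≤ y ^ 2) (hy : 0 ≤ y) : x ≤ y :=
  abs_le_of_sq_le_sq h hy |> (le_abs_self x).trans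

/-- Coordinate form of the inclusion, with `b`, `d` the depths below the horizontal axis. -/
lemma core_ineq (r a b c d n : ℝ) (hr : 0 < r) (ha : 0 ≤ a) (hb : 0 ≤ b) (hbr : b ≤ r / 2)
    (hx : a ^ 2 + b ^ 2 ≤ 2 * r * b) (hc : 0 ≤ c) (hn : 0 ≤ n) (hnr : n ≤ r)
    (hn2 : n ^ 2 = c ^ 2 + d ^ 2) (hd : n / 2 < d) :
    (a - c) ^ 2 + (b - d) ^ 2 ≤ r ^ 2 := by
  obtain ⟨s, hs0, hs⟩ : ∃ s : ℝ, 0 < s ∧ s ^ 2 = 3 :=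
    ⟨Real.sqrt 3, by positivity, Real.sq_sqrt (by norm_num)⟩
  obtain ⟨t, ht⟩ : ∃ t : ℝ, c = s * t := ⟨c / s, by field_simp⟩
  have ht0 : 0 ≤ t := by
    by_contra h
    push Not at h
    nlinarith
  have htd : t ≤ d := by
    apply le_of_sq_le_sq_aux _ (by linarith)
    subst ht
    nlinarith
  set S := a ^ 2 + b ^ 2 with hS
  have hS0 : 0 ≤ S := by positivity
  have hSr : S ≤ r ^ 2 := by nlinarith
  have h2 : S ≤ r * (s * a + b) := by
    apply le_of_sq_le_sq_aux _ (by positivity)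
    have h3 : S ≤ (s * a + b) ^ 2 := by
      have : (s * a + b) ^ 2 = 3 * a ^ 2 + 2 * (s * (a * b)) + b ^ 2 := by
        rw [← hs]; ring
      have h4 : 0 ≤ s * (a * b) := by positivity
      nlinarith [sq_nonneg a]
    calc S ^ 2 = S * S := by ring
      _ ≤ r ^ 2 * (s * a + b) ^ 2 := mul_le_mul hSr h3 hS0 (by positivity)
      _ = _ := by ring
  have hnle : n ≤ (d - t) + 2 * t := by
    apply le_of_sq_le_sq_aux _ (by linarith)
    subst ht
    rw [hn2, mul_pow, hs]
    nlinarith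
  have h5 : S * n ≤ 2 * r * (a * c + b * d) := by
    have e1 := mul_le_mul_of_nonneg_left hnle hS0
    have e2 := mul_le_mul_of_nonneg_right hx (sub_nonneg.2 htd)
    have e3 := mul_le_mul_of_nonneg_right h2 (by linarith : 0 ≤ 2 * t)
    subst ht
    nlinarith
  have h6 : 0 ≤ (r - n) * (r * (r + n) - S) :=
    mul_nonneg (by linarith) (by nlinarith [mul_nonneg hr.le hn])
  have h7 : r * ((a - c) ^ 2 + (b - d) ^ 2) ≤ r * r ^ 2 := by
    have : (a - c) ^ 2 + (b - d) ^ 2 = S - 2 * (a * c + b * d) + n ^ 2 := by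
      rw [hn2, hS]; ring
    rw [this]
    nlinarith
  exact le_of_mul_le_mul_left h7 hr

theorem statement15
    (α r ρ : ℝ) (hα : 0 < α) (hr : 0 < r) (hrα : r ≤ α) (hρ : 0 < ρ) (hρr : ρ ≤ r / 2)
    (h₁ : ℝ) (hh₁ : h₁ = ρ * (2 * α - ρ) / (2 * (α + r - ρ))) :
    ∀ Q ∈ ({Q1, Q2} : Set (Set E2)), ∀ y ∈ Q ∩ Fset r,
      Q ∩ Cset h₁ r ⊆ closedBall y r := by
  have hh : h₁ ≤ r / 2 := by
    rw [hh₁, div_le_iff₀ (by linarith)]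
    nlinarith
  have hin : ∀ z : E2, ⟪z, e₂⟫ = z 1 := by
    intro z
    simp [e₂, pt, PiLp.inner_apply, Fin.sum_univ_two]
  have key : ∀ x y : E2, ∀ a c : ℝ, 0 ≤ a → 0 ≤ c → a ^ 2 = x 0 ^ 2 → c ^ 2 = y 0 ^ 2 →
      (a - c) ^ 2 = (x 0 - y 0) ^ 2 → y ∈ Fset r → x ∈ Cset h₁ r → x ∈ closedBall y r := by
    rintro x y a c ha hc ha2 hc2 hac ⟨hy1, hy2⟩ ⟨⟨hx1, hx2⟩, hx3⟩
    rw [hin] at hx1 hx2 hy2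
    rw [mem_closedBall_zero_iff] at hy1
    have hyn : ‖y‖ ^ 2 = y 0 ^ 2 + y 1 ^ 2 := by
      rw [EuclideanSpace.real_norm_sq_eq, Fin.sum_univ_two]
    rw [mem_closedBall, dist_eq_norm] at hx3 ⊢
    have hx4 : ‖x - -(r • e₂)‖ ^ 2 ≤ r ^ 2 := by gcongr
    rw [EuclideanSpace.real_norm_sq_eq, Fin.sum_univ_two] at hx4
    simp [e₂, pt] at hx4
    have := core_ineq r a (-(x 1)) c (-(y 1)) ‖y‖ hr ha (by linarith) (by linarith)
      (by nlinarith) hc (norm_nonneg _) hy1 (by rw [hyn, hc2]; ring) (by linarith)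
    apply le_of_sq_le_sq_aux _ hr.le
    rw [EuclideanSpace.real_norm_sq_eq, Fin.sum_univ_two]
    simp only [PiLp.sub_apply]
    nlinarith
  rintro Q hQ y ⟨hy, hyF⟩ x ⟨hx, hxC⟩
  rcases hQ with rfl | rfl
  · exact key x y (x 0) (y 0) hx hy rfl rfl rfl hyF hxC
  · exact key x y (-(x 0)) (-(y 0)) (neg_nonneg.2 hx) (neg_nonneg.2 hy) (by ring) (by ring)
      (by ring) hyF hxC
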